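/- arXiv:1911.10359 — 2 statements merged into one kernel-verified Lean document; each statement's English description precedes it below -/
import Mathlib

section
/- Let A ∈ ℝ^{n×n}, B ∈ ℝ^{n×m}, K ∈ ℝ^{m×n}, let F ∈ ℝ^{N×N}, and let τ ≥ 0. Then the trivial solution of the global error dynamics δ̇(t) = (I_N ⊗ A) δ(t) − (F ⊗ BK) δ(t−τ) is asymptotically stable (every solution δ : ℝ → ℝ^{Nn} tends to 0 as t → ∞) if and only if, for every complex eigenvalue λ of F, the trivial solution of the n-dimensional complex delay system ẋ(t) = A x(t) − λ BK x(t−τ) is asymptotically stable (every solution x : ℝ → ℂⁿ tends to 0 as t → ∞). -/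
open Matrix Filter
open scoped Kronecker 
open scoped BoundedContinuousFunction

namespace DDE
variable {E : Type*} [NormedAddCommGroup E] [NormedSpace ℝ E]

/-- Mild (integral) solutions of the forced delay equation. -/
def IsSol (P Q : E →L[ℝ] E) (τ : ℝ) (f : ℝ → E) (x : ℝ → E) : Prop :=
  Continuous x ∧ ∀ t : ℝ, 0 ≤ t →
    x t = x 0 + ∫ s in (0 : ℝ)..t, (P (x s) + Q (x (s - τ)) + f s)

lemma integral_exp_bound (g : ℝ → E) {κ M c η t : ℝ} (hM : 0 ≤ M) (hc : 0 < c)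
    (hκ : 2 * κ ≤ c) (hκ0 : 0 ≤ κ) (ht : 0 ≤ t)
    (hg : ∀ s, 0 ≤ s → s ≤ t → ‖g s‖ ≤ κ * M * Real.exp (c * s) + η) :
    ‖∫ s in (0 : ℝ)..t, g s‖ ≤ M / 2 * Real.exp (c * t) + η * t := by
  have hd : ∀ s : ℝ, HasDerivAt (fun s => κ * M / c * Real.exp (c * s) + η * s)
      (κ * M * Real.exp (c * s) + η) s := by
    intro s
    have h1 : HasDerivAt (fun s : ℝ => c * s) c s := by
      simpa using (hasDerivAt_id s).const_mul c
    have h2 := (h1.exp.const_mul (κ * M / c)).add ((hasDerivAt_id s).const_mul η)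
    refine h2.congr_deriv ?_
    field_simp
  have hcont : Continuous (fun s : ℝ => κ * M * Real.exp (c * s) + η) := by fun_prop
  have h1 := intervalIntegral.norm_integral_le_of_norm_le (f := g)
    (μ := MeasureTheory.volume) ht
    (MeasureTheory.ae_of_all _ (fun s hs => hg s hs.1.le hs.2)) (hcont.intervalIntegrable 0 t)
  rw [intervalIntegral.integral_eq_sub_of_hasDerivAt (fun s _ => hd s)
    (hcont.intervalIntegrable 0 t)] at h1
  have h2 : κ * M / c ≤ M / 2 := by
    rw [div_le_div_iff₀ hc (by norm_num)]; nlinarith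
  have h3 : 0 ≤ κ * M / c := by positivity
  have h4 := Real.exp_pos (c * t)
  simp only [mul_zero, Real.exp_zero, mul_one, add_zero] at h1
  nlinarith

/-- Delay Gronwall estimate. -/
lemma gronwall (P Q : E →L[ℝ] E) {τ : ℝ} (hτ : 0 ≤ τ) {f d : ℝ → E} (h : IsSol P Q τ f d)
    (h0 : ∀ s, -τ ≤ s → s ≤ 0 → d s = 0) {H η : ℝ} (hH : 0 ≤ H)
    (hf : ∀ s, 0 ≤ s → s ≤ H → ‖f s‖ ≤ η) :
    ∀ t, 0 ≤ t → t ≤ H →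
      ‖d t‖ ≤ 2 * H * Real.exp ((2 * (‖P‖ + ‖Q‖) + 1) * H) * η := by
  obtain ⟨hd, he⟩ := h
  set c := 2 * (‖P‖ + ‖Q‖) + 1 with hcdef
  have hc : 0 < c := by positivity
  have hη : 0 ≤ η := (norm_nonneg _).trans (hf 0 le_rfl hH)
  obtain ⟨t₀, ht₀, hmax⟩ := (isCompact_Icc (a := (0 : ℝ)) (b := H)).exists_isMaxOn
    ⟨0, le_rfl, hH⟩ (f := fun t => Real.exp (-(c * t)) * ‖d t‖) (by fun_prop)
  set M := Real.exp (-(c * t₀)) * ‖d t₀‖ with hMdef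
  have hM : 0 ≤ M := by positivity
  have hb : ∀ s, 0 ≤ s → s ≤ H → ‖d s‖ ≤ M * Real.exp (c * s) := by
    intro s h1 h2
    have h3 : Real.exp (-(c * s)) * ‖d s‖ ≤ M := hmax ⟨h1, h2⟩
    have h4 : Real.exp (-(c * s)) * Real.exp (c * s) = 1 := by
      rw [← Real.exp_add]; simp
    have h5 := mul_le_mul_of_nonneg_right h3 (Real.exp_pos (c * s)).le
    calc ‖d s‖ = Real.exp (-(c * s)) * Real.exp (c * s) * ‖d s‖ := by rw [h4, one_mul]
      _ = Real.exp (-(c * s)) * ‖d s‖ * Real.exp (c * s) := by ring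
      _ ≤ _ := h5
  have hb' : ∀ s, 0 ≤ s → s ≤ H → ‖d (s - τ)‖ ≤ M * Real.exp (c * s) := by
    intro s h1 h2
    rcases le_total (s - τ) 0 with h3 | h3
    · rw [h0 _ (by linarith) h3]; simp; positivity
    · refine (hb _ h3 (by linarith)).trans ?_
      gcongr; linarith
  have key := integral_exp_bound (fun s => P (d s) + Q (d (s - τ)) + f s)
    (κ := ‖P‖ + ‖Q‖) (M := M) (c := c) (η := η) (t := t₀) hM hc (by linarith) (by positivity) ht₀.1
    (by
      intro s h1 h2
      have e1 := P.le_opNorm_of_le (hb s h1 (h2.trans ht₀.2))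
      have e2 := Q.le_opNorm_of_le (hb' s h1 (h2.trans ht₀.2))
      have e3 := hf s h1 (h2.trans ht₀.2)
      have e4 := norm_add₃_le (a := P (d s)) (b := Q (d (s - τ))) (c := f s)
      linarith)
  have e0 : d 0 = 0 := h0 0 (by linarith) le_rfl
  have e1 := he t₀ ht₀.1
  rw [e0, zero_add] at e1
  rw [← e1] at key
  have hMle : M ≤ 2 * H * η := by
    have h4 : Real.exp (-(c * t₀)) * Real.exp (c * t₀) = 1 := by
      rw [← Real.exp_add]; simp
    have h5 := mul_le_mul_of_nonneg_left key (Real.exp_pos (-(c * t₀))).le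
    rw [← hMdef] at h5
    have h6 : Real.exp (-(c * t₀)) ≤ 1 := by
      rw [Real.exp_le_one_iff]; have := mul_nonneg hc.le ht₀.1; linarith
    have h7 : Real.exp (-(c * t₀)) * (η * t₀) ≤ 1 * (η * H) := by
      have := ht₀.1; have := ht₀.2
      gcongr
    have h8 : Real.exp (-(c * t₀)) * (M / 2 * Real.exp (c * t₀) + η * t₀) 
      = M / 2 * (Real.exp (-(c * t₀)) * Real.exp (c * t₀)) + Real.exp (-(c * t₀)) * (η * t₀) := by ring
    rw [h8, h4] at h5
    linarith
  intro t h1 h2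
  calc ‖d t‖ ≤ M * Real.exp (c * t) := hb t h1 h2
    _ ≤ (2 * H * η) * Real.exp (c * H) := by gcongr
    _ = _ := by ring

lemma IsSol.sub {P Q : E →L[ℝ] E} {τ : ℝ} {f g x y : ℝ → E} (hf : Continuous f)
    (hg : Continuous g) (hx : IsSol P Q τ f x) (hy : IsSol P Q τ g y) :
    IsSol P Q τ (f - g) (x - y) := by
  obtain ⟨hx, hx'⟩ := hx
  obtain ⟨hy, hy'⟩ := hy
  refine ⟨hx.sub hy, fun t ht => ?_⟩
  have c1 : Continuous (fun s => P (x s) + Q (x (s - τ)) + f s) := by fun_prop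
  have c2 : Continuous (fun s => P (y s) + Q (y (s - τ)) + g s) := by fun_prop
  have h := intervalIntegral.integral_sub (c1.intervalIntegrable (μ := MeasureTheory.volume) 0 t)
    (c2.intervalIntegrable 0 t)
  have h2 : (∫ s in (0 : ℝ)..t, (P ((x - y) s) + Q ((x - y) (s - τ)) + (f - g) s)) = 
     ∫ s in (0 : ℝ)..t, ((P (x s) + Q (x (s - τ)) + f s) - (P (y s) + Q (y (s - τ)) + g s)) := by
    congr 1; ext s; simp only [Pi.sub_apply, map_sub]; abel
  rw [h2, h, Pi.sub_apply, hx' t ht, hy' t ht, Pi.sub_apply]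
  abel

lemma IsSol.shift {P Q : E →L[ℝ] E} {τ : ℝ} {f x : ℝ → E} (hf : Continuous f)
    (hx : IsSol P Q τ f x) {a : ℝ} (ha : 0 ≤ a) :
    IsSol P Q τ (fun s => f (s + a)) (fun s => x (s + a)) := by
  obtain ⟨hx, hx'⟩ := hx
  refine ⟨by fun_prop, fun t ht => ?_⟩
  have c1 : Continuous (fun s => P (x s) + Q (x (s - τ)) + f s) := by fun_prop
  have h := intervalIntegral.integral_comp_add_right (a := 0) (b := t)
    (fun s => P (x s) + Q (x (s - τ)) + f s) a
  have h2 : (∫ s in (0 : ℝ)..t, (P (x (s + a)) + Q (x (s - τ + a)) + f (s + a))) =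
    ∫ s in (0 : ℝ)..t, (P (x (s + a)) + Q (x (s + a - τ)) + f (s + a)) := by
    congr 1; ext s; rw [sub_add_eq_add_sub]
  rw [h2, h]
  simp only [zero_add]
  rw [hx' (t + a) (by linarith)]
  rw [hx' a ha, add_assoc, intervalIntegral.integral_add_adjacent_intervals
    (c1.intervalIntegrable _ _) (c1.intervalIntegrable _ _)]

lemma exists_sol [CompleteSpace E] (P Q : E →L[ℝ] E) {τ : ℝ} (hτ : 0 ≤ τ) (φ : ℝ →ᵇ E) :
    ∃ x : ℝ → E, IsSol P Q τ 0 x ∧ ∀ t ≤ 0, x t = φ t := by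
  set c := 2 * (‖P‖ + ‖Q‖) + 1 with hcdef
  have hc : 0 < c := by positivity
  let X : (ℝ →ᵇ E) → ℝ → E := fun w s => Real.exp (c * max s 0) • w s
  have hX : ∀ w, Continuous (X w) := fun w => by
    have := w.continuous
    fun_prop
  let G : (ℝ →ᵇ E) → ℝ → E := fun w s => P (X w s) + Q (X w (s - τ))
  have hG : ∀ w, Continuous (G w) := fun w => by
    have := hX w
    fun_prop
  have hGs : ∀ w v s, G w s - G v s = G (w - v) s := by
    intro w v s
    simp only [G, X, BoundedContinuousFunction.sub_apply, smul_sub, map_sub]; abel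
  have hXn : ∀ w s, ‖X w s‖ ≤ ‖w‖ * Real.exp (c * max s 0) := by
    intro w s
    simp only [X, norm_smul, Real.norm_eq_abs, Real.abs_exp]
    rw [mul_comm]
    gcongr
    exact w.norm_coe_le_norm s
  have hGn : ∀ w s, 0 ≤ s → ‖G w s‖ ≤ (‖P‖ + ‖Q‖) * ‖w‖ * Real.exp (c * s) + 0 := by
    intro w s hs
    have e1 := P.le_opNorm_of_le (hXn w s)
    have e2' : ‖X w (s - τ)‖ ≤ ‖w‖ * Real.exp (c * s) := by
      refine (hXn w _).trans ?_
      gcongr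
      exact max_le (by linarith) hs
    have e2 := Q.le_opNorm_of_le e2'
    rw [max_eq_left hs] at e1
    have e4 := norm_add_le (P (X w s)) (Q (X w (s - τ)))
    simp only [G]
    linarith
  have hI : ∀ w t, ‖∫ s in (0 : ℝ)..(max t 0), G w s‖ ≤ ‖w‖ / 2 * Real.exp (c * max t 0) := by
    intro w t
    have := integral_exp_bound (G w) (κ := ‖P‖ + ‖Q‖) (M := ‖w‖) (c := c) (η := 0)
      (t := max t 0) (norm_nonneg _) hc (by linarith) (by positivity) (le_max_right _ _)
      (fun s h1 _ => hGn w s h1)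
    simpa using this
  have hexp : ∀ t : ℝ, Real.exp (-(c * max t 0)) * Real.exp (c * max t 0) = 1 := by
    intro t; rw [← Real.exp_add]; simp
  have hI' : ∀ w t, ‖Real.exp (-(c * max t 0)) • ∫ s in (0 : ℝ)..(max t 0), G w s‖ ≤ ‖w‖ / 2 := by
    intro w t
    rw [norm_smul, Real.norm_eq_abs, Real.abs_exp]
    calc _ ≤ Real.exp (-(c * max t 0)) * (‖w‖ / 2 * Real.exp (c * max t 0)) := by
          gcongr; exact hI w t
      _ = (Real.exp (-(c * max t 0)) * Real.exp (c * max t 0)) * (‖w‖ / 2) := by ring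
      _ = _ := by rw [hexp, one_mul]
  let Jf : (ℝ →ᵇ E) → ℝ → E := fun w t => 
    Real.exp (-(c * max t 0)) • φ (min t 0) +
      Real.exp (-(c * max t 0)) • ∫ s in (0 : ℝ)..(max t 0), G w s
  have hJc : ∀ w, Continuous (Jf w) := by
    intro w
    have h1 : Continuous (fun b => ∫ s in (0 : ℝ)..b, G w s) :=
      intervalIntegral.continuous_primitive (fun a b => (hG w).intervalIntegrable a b) 0
    have h2 : Continuous (fun t : ℝ => ∫ s in (0 : ℝ)..(max t 0), G w s) :=
      h1.comp (continuous_id.max continuous_const)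
    have := φ.continuous
    fun_prop
  have hJb : ∀ w t, ‖Jf w t‖ ≤ ‖φ‖ + ‖w‖ / 2 := by
    intro w t
    refine (norm_add_le _ _).trans (add_le_add ?_ (hI' w t))
    rw [norm_smul, Real.norm_eq_abs, Real.abs_exp]
    have h6 : Real.exp (-(c * max t 0)) ≤ 1 := by
      rw [Real.exp_le_one_iff]; have := mul_nonneg hc.le (le_max_right t 0); linarith
    calc _ ≤ 1 * ‖φ‖ := by
          gcongr; exact φ.norm_coe_le_norm _
      _ = _ := one_mul _
  let J : (ℝ →ᵇ E) → (ℝ →ᵇ E) := fun w =>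
    BoundedContinuousFunction.ofNormedAddCommGroup (Jf w) (hJc w) _ (hJb w)
  have hJ : ContractingWith (1 / 2) J := by
    refine ⟨by rw [← NNReal.coe_lt_coe]; norm_num, LipschitzWith.of_dist_le_mul fun w v => ?_⟩
    rw [BoundedContinuousFunction.dist_le (by positivity)]
    intro t
    have : J w t - J v t = Real.exp (-(c * max t 0)) • ∫ s in (0 : ℝ)..(max t 0), G (w - v) s := by
      simp only [J, BoundedContinuousFunction.coe_ofNormedAddCommGroup, Jf]
      rw [add_sub_add_left_eq_sub, ← smul_sub, ← intervalIntegral.integral_sub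
        ((hG w).intervalIntegrable _ _) ((hG v).intervalIntegrable _ _)]
      simp only [hGs]
    rw [dist_eq_norm, this, dist_eq_norm]
    refine (hI' _ _).trans (le_of_eq ?_)
    simp; ring
  obtain ⟨w, hw⟩ : ∃ w, J w = w := ⟨_, hJ.fixedPoint_isFixedPt⟩
  have hwt : ∀ t, X w t = φ (min t 0) + ∫ s in (0 : ℝ)..(max t 0), G w s := by
    intro t
    have : w t = Jf w t := by conv_lhs => rw [← hw]
                              rfl
    simp only [X]
    rw [this]
    simp only [Jf]
    rw [← smul_add, smul_smul, mul_comm, hexp, one_smul]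
  refine ⟨X w, ⟨hX w, fun t ht => ?_⟩, fun t ht => ?_⟩
  · rw [hwt t, hwt 0]
    simp [ht, G]
  · rw [hwt t]; simp [ht]

/-- classical solutions decay implies mild solutions decay -/
lemma mild_decay [CompleteSpace E] (P Q : E →L[ℝ] E) {τ : ℝ} (hτ : 0 ≤ τ)
    (H : ∀ x : ℝ → E, ContDiff ℝ 1 x →
      (∀ t : ℝ, 0 ≤ t → HasDerivAt x (P (x t) + Q (x (t - τ))) t) → Tendsto x atTop (nhds 0))
    (x : ℝ → E) (hx : IsSol P Q τ 0 x) : Tendsto x atTop (nhds 0) := by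
  obtain ⟨hc, he⟩ := hx
  let g : ℝ → E := fun s => P (x (max s 0)) + Q (x (max s 0 - τ))
  have hg : Continuous g := by fun_prop
  let y : ℝ → E := fun t => x 0 + ∫ s in (0 : ℝ)..(t + τ), g s
  have hyd : ∀ t, HasDerivAt y (g (t + τ)) t := by
    intro t
    have h1 := (hg.integral_hasStrictDerivAt 0 (t + τ)).hasDerivAt
    exact (h1.comp_add_const t τ).const_add (x 0)
  have hyx : ∀ t, -τ ≤ t → y t = x (t + τ) := by
    intro t ht
    rw [he (t + τ) (by linarith)]
    simp only [y]
    congr 1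
    apply intervalIntegral.integral_congr
    intro s hs
    rw [Set.uIcc_of_le (by linarith)] at hs
    simp [g, hs.1]
  have hy : Tendsto y atTop (nhds 0) := by
    apply H
    · rw [contDiff_one_iff_deriv]
      refine ⟨fun t => (hyd t).differentiableAt, ?_⟩
      have : deriv y = fun t => g (t + τ) := by ext1 t; exact (hyd t).deriv
      rw [this]; fun_prop
    · intro t ht
      convert hyd t using 1
      rw [hyx t (by linarith), hyx (t - τ) (by linarith)]
      simp only [g]
      rw [max_eq_left (by linarith), sub_add_cancel, add_sub_cancel_right]
  have h2 : Tendsto (fun t => y (t - τ)) atTop (nhds 0) :=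
    hy.comp (tendsto_atTop_add_const_right atTop (-τ) tendsto_id)
  refine h2.congr' ?_
  filter_upwards [eventually_ge_atTop 0] with t ht
  rw [hyx _ (by linarith), sub_add_cancel]

lemma IsSol.smul {P Q : E →L[ℝ] E} {τ : ℝ} {x : ℝ → E} (hx : IsSol P Q τ 0 x) (a : ℝ) :
    IsSol P Q τ 0 (a • x) := by
  obtain ⟨hx, hx'⟩ := hx
  refine ⟨hx.const_smul a, fun t ht => ?_⟩
  have h2 : (∫ s in (0 : ℝ)..t, (P ((a • x) s) + Q ((a • x) (s - τ)) + (0 : ℝ → E) s)) =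
     ∫ s in (0 : ℝ)..t, a • (P (x s) + Q (x (s - τ)) + (0 : ℝ → E) s) := by
    congr 1; ext s; simp
  rw [h2, intervalIntegral.integral_smul, Pi.smul_apply, Pi.smul_apply, ← smul_add, ← hx' t ht]

/-- defect functional -/
noncomputable def defect (P Q : E →L[ℝ] E) (τ t : ℝ) : (ℝ →ᵇ E) →L[ℝ] E :=
  LinearMap.mkContinuous
    { toFun := fun x => x t - x 0 - ∫ s in (0 : ℝ)..t, (P (x s) + Q (x (s - τ)))
      map_add' := by
        intro x y
        have hx := x.continuous
        have hy := y.continuous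
        have c1 : Continuous (fun s => P (x s) + Q (x (s - τ))) := by fun_prop
        have c2 : Continuous (fun s => P (y s) + Q (y (s - τ))) := by fun_prop
        have h := intervalIntegral.integral_add
          (c1.intervalIntegrable (μ := MeasureTheory.volume) 0 t) (c2.intervalIntegrable 0 t)
        have h2 : (∫ s in (0 : ℝ)..t, (P ((x + y) s) + Q ((x + y) (s - τ)))) =
            ∫ s in (0 : ℝ)..t, ((P (x s) + Q (x (s - τ))) + (P (y s) + Q (y (s - τ)))) := by
          congr 1; ext s; simp only [BoundedContinuousFunction.add_apply, map_add]; abel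
        rw [h2, h]
        simp only [BoundedContinuousFunction.add_apply]
        abel
      map_smul' := by
        intro a x
        have h2 : (∫ s in (0 : ℝ)..t, (P ((a • x) s) + Q ((a • x) (s - τ)))) =
            ∫ s in (0 : ℝ)..t, a • (P (x s) + Q (x (s - τ))) := by
          congr 1; ext s; simp
        rw [h2, intervalIntegral.integral_smul]
        simp [smul_sub] }
    (2 + (‖P‖ + ‖Q‖) * |t - 0|) (by
      intro x
      have h1 : ‖∫ s in (0 : ℝ)..t, (P (x s) + Q (x (s - τ)))‖ ≤
          ((‖P‖ + ‖Q‖) * ‖x‖) * |t - 0| := by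
        apply intervalIntegral.norm_integral_le_of_norm_le_const
        intro s _
        have e1 := P.le_opNorm_of_le (x.norm_coe_le_norm s)
        have e2 := Q.le_opNorm_of_le (x.norm_coe_le_norm (s - τ))
        have e3 := norm_add_le (P (x s)) (Q (x (s - τ)))
        linarith
      have h2 := norm_sub_le (x t - x 0) (∫ s in (0 : ℝ)..t, (P (x s) + Q (x (s - τ))))
      have h3 := norm_sub_le (x t) (x 0)
      have h4 := x.norm_coe_le_norm t
      have h5 := x.norm_coe_le_norm 0
      simp only [LinearMap.coe_mk, AddHom.coe_mk]
      linarith)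

lemma isSol_iff_defect (P Q : E →L[ℝ] E) (τ : ℝ) (x : ℝ →ᵇ E) :
    IsSol P Q τ 0 x ↔ ∀ t : Set.Ici (0 : ℝ), defect P Q τ t x = 0 := by
  have h : ∀ t, defect P Q τ t x = x t - x 0 - ∫ s in (0 : ℝ)..t, (P (x s) + Q (x (s - τ))) :=
    fun t => rfl
  simp only [IsSol, h, x.continuous, true_and, Subtype.forall, Set.mem_Ici, Pi.zero_apply, add_zero,
    sub_eq_iff_eq_add']

/-- space of bounded solutions -/
noncomputable def solSpace (P Q : E →L[ℝ] E) (τ : ℝ) : Submodule ℝ (ℝ →ᵇ E) :=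
  ⨅ t : Set.Ici (0 : ℝ), (defect P Q τ t).ker

lemma mem_solSpace (P Q : E →L[ℝ] E) (τ : ℝ) (x : ℝ →ᵇ E) :
    x ∈ solSpace P Q τ ↔ IsSol P Q τ 0 x := by
  rw [isSol_iff_defect, solSpace, Submodule.mem_iInf]
  rfl

lemma isClosed_solSpace (P Q : E →L[ℝ] E) (τ : ℝ) :
    IsClosed (solSpace P Q τ : Set (ℝ →ᵇ E)) := by
  rw [solSpace, Submodule.coe_iInf]
  exact isClosed_iInter fun t => (defect P Q τ t).isClosed_ker

lemma uniform_bound [CompleteSpace E] (P Q : E →L[ℝ] E) {τ : ℝ} (hτ : 0 ≤ τ)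
    (H : ∀ x : ℝ → E, IsSol P Q τ 0 x → Tendsto x atTop (nhds 0)) :
    ∃ M > 0, ∀ φ : Set.Icc (-τ) 0 →ᵇ E, ∃ x : ℝ → E, IsSol P Q τ 0 x ∧
      (∀ u : Set.Icc (-τ) 0, x u = φ u) ∧ ∀ t, ‖x t‖ ≤ M * ‖φ‖ := by
  have : CompleteSpace (solSpace P Q τ) := (isClosed_solSpace P Q τ).completeSpace_coe
  let ι : C(Set.Icc (-τ) 0, ℝ) := ⟨Subtype.val, continuous_subtype_val⟩
  let R : solSpace P Q τ →L[ℝ] (Set.Icc (-τ) 0 →ᵇ E) :=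
    LinearMap.mkContinuous
      { toFun := fun x => (x : ℝ →ᵇ E).compContinuous ι
        map_add' := fun x y => rfl
        map_smul' := fun a x => rfl } 1 (by
        intro x
        rw [one_mul]
        refine (BoundedContinuousFunction.norm_le (norm_nonneg _)).2 fun u => ?_
        exact (x : ℝ →ᵇ E).norm_coe_le_norm _)
  have hR : Function.Surjective R := by
    intro φ
    have hle : -τ ≤ 0 := by linarith
    let φ' : ℝ →ᵇ E := φ.compContinuous ⟨Set.projIcc (-τ) 0 hle, continuous_projIcc⟩
    obtain ⟨x, hx, hxφ⟩ := exists_sol P Q hτ φ'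
    have hlim := H x hx
    obtain ⟨T, hT⟩ := eventually_atTop.1 (hlim.norm.eventually_lt_const (u := 1) (by simp))
    obtain ⟨C, hC⟩ := (isCompact_Icc (a := 0) (b := T)).exists_bound_of_continuousOn
      hx.1.continuousOn
    have hb : ∀ t, ‖x t‖ ≤ max ‖φ'‖ (max 1 C) := by
      intro t
      rcases le_total t 0 with h | h
      · rw [hxφ t h]; exact le_max_of_le_left (φ'.norm_coe_le_norm t)
      · rcases le_total t T with h' | h'
        · exact le_max_of_le_right (le_max_of_le_right (hC t ⟨h, h'⟩))
        · exact le_max_of_le_right (le_max_of_le_left (hT t h').le)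
    let xb : ℝ →ᵇ E := BoundedContinuousFunction.ofNormedAddCommGroup x hx.1 _ hb
    refine ⟨⟨xb, (mem_solSpace P Q τ xb).2 hx⟩, ?_⟩
    ext u
    change x u = φ u
    rw [hxφ u u.2.2]
    change φ (Set.projIcc (-τ) 0 hle u) = φ u
    rw [Set.projIcc_val]
  obtain ⟨M, hM, h⟩ := R.exists_preimage_norm_le hR
  refine ⟨M, hM, fun φ => ?_⟩
  obtain ⟨x, hx, hn⟩ := h φ
  refine ⟨(x : ℝ →ᵇ E), (mem_solSpace P Q τ _).1 x.2, fun u => ?_, fun t => ?_⟩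
  · rw [← hx]; rfl
  · exact ((x : ℝ →ᵇ E).norm_coe_le_norm t).trans hn

lemma contraction [FiniteDimensional ℝ E] (P Q : E →L[ℝ] E) {τ : ℝ} (hτ : 0 ≤ τ)
    (H : ∀ x : ℝ → E, IsSol P Q τ 0 x → Tendsto x atTop (nhds 0)) :
    ∃ M > 0, ∃ h > 0, τ ≤ h ∧ ∀ φ : Set.Icc (-τ) 0 →ᵇ E, ∃ x : ℝ → E, IsSol P Q τ 0 x ∧
      (∀ u : Set.Icc (-τ) 0, x u = φ u) ∧ (∀ t, ‖x t‖ ≤ M * ‖φ‖) ∧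
      ∀ t, h - τ ≤ t → ‖x t‖ ≤ ‖φ‖ / 2 := by
  have : CompleteSpace E := FiniteDimensional.complete ℝ E
  have : ProperSpace E := FiniteDimensional.proper ℝ E
  obtain ⟨M, hM, hbd⟩ := uniform_bound P Q hτ H
  let L : ℝ := (‖P‖ + ‖Q‖) * M
  let A : Set (Set.Icc (-τ) 0 →ᵇ E) :=
    {ψ | (∀ u, ψ u ∈ Metric.closedBall (0 : E) M) ∧ ∀ u v, dist (ψ u) (ψ v) ≤ L * dist u v}
  have hA : IsCompact (closure A) := by
    apply BoundedContinuousFunction.arzela_ascoli _ (isCompact_closedBall (0 : E) M) A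
    · intro f u hf; exact hf.1 u
    · apply Metric.equicontinuous_of_continuity_modulus (fun r => L * r)
      · have : Continuous (fun r : ℝ => L * r) := by fun_prop
        simpa using this.tendsto 0
      · intro u v f; exact f.2.2 u v
  have htb : TotallyBounded A := hA.totallyBounded.subset subset_closure
  obtain ⟨S, hS, hcov⟩ := Metric.totallyBounded_iff.1 htb (1 / (4 * M)) (by positivity)
  choose Z hZ1 hZ2 hZ3 using hbd
  have hev : ∀ᶠ t in atTop, ∀ ψ ∈ S, ‖Z ψ t‖ < 1 / 4 := by
    rw [Filter.eventually_all_finite hS]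
    intro ψ _
    exact (H _ (hZ1 ψ)).norm.eventually (gt_mem_nhds (by simp))
  obtain ⟨T, hT⟩ := eventually_atTop.1 hev
  have claim : ∀ x : ℝ → E, IsSol P Q τ 0 x → (∀ t, ‖x t‖ ≤ M) →
      ∀ t, max T 0 + τ ≤ t → ‖x t‖ ≤ 1 / 2 := by
    intro x hx hxb t ht
    have hxc := hx.1
    have hlip : ∀ r s, 0 ≤ r → 0 ≤ s → dist (x r) (x s) ≤ L * dist r s := by
      intro r s hr hs
      have c1 : Continuous (fun s => P (x s) + Q (x (s - τ)) + (0 : ℝ → E) s) := by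
        simp only [Pi.zero_apply]; fun_prop
      rw [dist_eq_norm, hx.2 r hr, hx.2 s hs, add_sub_add_left_eq_sub,
        intervalIntegral.integral_interval_sub_left (c1.intervalIntegrable _ _)
          (c1.intervalIntegrable _ _), Real.dist_eq]
      apply intervalIntegral.norm_integral_le_of_norm_le_const
      intro s _
      have e1 := P.le_opNorm_of_le (hxb s)
      have e2 := Q.le_opNorm_of_le (hxb (s - τ))
      have e3 := norm_add_le (P (x s)) (Q (x (s - τ)))
      simp only [Pi.zero_apply, add_zero, L]
      linarith
    let ψ : Set.Icc (-τ) 0 →ᵇ E := BoundedContinuousFunction.mkOfCompact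
      ⟨fun u => x (u + τ), by fun_prop⟩
    have hψ : ψ ∈ A := by
      refine ⟨fun u => ?_, fun u v => ?_⟩
      · rw [mem_closedBall_zero_iff]; exact hxb _
      · have := hlip (u + τ) (v + τ) (by linarith [u.2.1]) (by linarith [v.2.1])
        rw [dist_add_right] at this
        exact this
    obtain ⟨y, hy, hyd⟩ := Set.mem_iUnion₂.1 (hcov hψ)
    have hnorm : ‖ψ - y‖ ≤ 1 / (4 * M) := by
      rw [← dist_eq_norm]; exact (Metric.mem_ball.1 hyd).le
    have hsol := ((hx.shift continuous_zero hτ).sub continuous_zero continuous_zero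
      (hZ1 y)).sub (continuous_zero.sub continuous_zero) continuous_zero (hZ1 (ψ - y))
    have ht0 : 0 ≤ t - τ := by linarith [le_max_right T 0]
    have hg := gronwall P Q hτ hsol (H := t - τ) (η := 0) (by
      intro s h1 h2
      have a1 := hZ2 y ⟨s, h1, h2⟩
      have a2 := hZ2 (ψ - y) ⟨s, h1, h2⟩
      have a3 : ψ ⟨s, h1, h2⟩ = x (s + τ) := rfl
      simp only [BoundedContinuousFunction.sub_apply] at a2
      simp only [Pi.sub_apply]
      rw [a1, a2, a3]; abel) ht0 (by intro s _ _; simp) (t - τ) ht0 le_rfl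
    rw [mul_zero] at hg
    have hz := norm_le_zero_iff.1 hg
    simp only [Pi.sub_apply, sub_add_cancel] at hz
    have hz' : x t = Z (ψ - y) (t - τ) + Z y (t - τ) := by
      rw [sub_sub, sub_eq_zero] at hz
      rw [hz, add_comm]
    have b1 := hZ3 (ψ - y) (t - τ)
    have b2 := hT (t - τ) (by linarith [le_max_left T 0]) y hy
    have b3 : M * ‖ψ - y‖ ≤ 1 / 4 := by
      calc _ ≤ M * (1 / (4 * M)) := by gcongr
        _ = 1 / 4 := by field_simp
    have b4 := norm_add_le (Z (ψ - y) (t - τ)) (Z y (t - τ))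
    rw [hz']
    linarith
  refine ⟨M, hM, max T 0 + 2 * τ + 1, by positivity, by linarith [le_max_right T 0], fun φ => ?_⟩
  refine ⟨Z φ, hZ1 φ, hZ2 φ, hZ3 φ, fun t ht => ?_⟩
  rcases (norm_nonneg φ).eq_or_lt with h0 | h0
  · have := hZ3 φ t
    rw [← h0] at this ⊢
    simpa using this
  · have h1 := claim (‖φ‖⁻¹ • Z φ) ((hZ1 φ).smul _) (by
      intro s
      rw [Pi.smul_apply, norm_smul, norm_inv, norm_norm, inv_mul_le_iff₀ h0, mul_comm]
      exact hZ3 φ s) t (by linarith)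
    rw [Pi.smul_apply, norm_smul, norm_inv, norm_norm, inv_mul_le_iff₀ h0] at h1
    linarith

/-- Forced equations with vanishing forcing have vanishing solutions. -/
lemma forced_decay [FiniteDimensional ℝ E] (P Q : E →L[ℝ] E) {τ : ℝ} (hτ : 0 ≤ τ)
    (H : ∀ x : ℝ → E, IsSol P Q τ 0 x → Tendsto x atTop (nhds 0))
    {f x : ℝ → E} (hf : Continuous f) (hf0 : Tendsto f atTop (nhds 0)) (hx : IsSol P Q τ f x) :
    Tendsto x atTop (nhds 0) := by
  obtain ⟨M, hM, h, hh, hτh, hsel⟩ := contraction P Q hτ H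
  have hxc := hx.1
  let C : ℝ := 2 * h * Real.exp ((2 * (‖P‖ + ‖Q‖) + 1) * h)
  have hC : 0 < C := by positivity
  rw [Metric.tendsto_atTop]
  intro ε hε
  set η := ε / (2 * C * (3 * M + 1)) with hη
  have hη0 : 0 < η := by positivity
  obtain ⟨T', hT'⟩ := eventually_atTop.1 (hf0.norm.eventually_lt_const (u := η) (by simpa))
  set T := max T' 0
  have hT : ∀ s, T ≤ s → ‖f s‖ ≤ η := fun s hs => (hT' s ((le_max_left _ _).trans hs)).le
  have hT0 : 0 ≤ T := le_max_right _ _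
  have step : ∀ t₀, T ≤ t₀ → ∀ r, 0 ≤ r → (∀ u, -τ ≤ u → u ≤ 0 → ‖x (u + t₀)‖ ≤ r) →
      (∀ t, 0 ≤ t → t ≤ h → ‖x (t + t₀)‖ ≤ M * r + C * η) ∧
      (∀ u, -τ ≤ u → u ≤ 0 → ‖x (u + (t₀ + h))‖ ≤ r / 2 + C * η) := by
    intro t₀ ht₀ r hr hxr
    let φ : Set.Icc (-τ) 0 →ᵇ E := BoundedContinuousFunction.mkOfCompact
      ⟨fun u => x (u + t₀), by fun_prop⟩
    have hφ : ‖φ‖ ≤ r := (BoundedContinuousFunction.norm_le hr).2 fun u => hxr u u.2.1 u.2.2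
    obtain ⟨y, hy, hyφ, hyM, hyh⟩ := hsel φ
    have hsol := (hx.shift hf (hT0.trans ht₀)).sub (by fun_prop) continuous_zero hy
    have hg := gronwall P Q hτ hsol (H := h) (η := η) (by
      intro s h1 h2
      have := hyφ ⟨s, h1, h2⟩
      simp only [Pi.sub_apply]
      rw [this, sub_eq_zero]; rfl) hh.le (by
      intro s h1 _
      simp only [Pi.sub_apply, Pi.zero_apply, sub_zero]
      exact hT _ (by linarith))
    have hg' : ∀ t, 0 ≤ t → t ≤ h → ‖x (t + t₀)‖ ≤ ‖y t‖ + C * η := by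
      intro t h1 h2
      have a1 := hg t h1 h2
      have a2 := norm_le_norm_add_norm_sub' (x (t + t₀)) (y t)
      simp only [Pi.sub_apply] at a1
      linarith
    refine ⟨fun t h1 h2 => ?_, fun u h1 h2 => ?_⟩
    · have a1 := hg' t h1 h2
      have a2 := hyM t
      have a3 : M * ‖φ‖ ≤ M * r := by gcongr
      linarith
    · have a1 := hg' (u + h) (by linarith) (by linarith)
      have a2 := hyh (u + h) (by linarith)
      have e : u + (t₀ + h) = u + h + t₀ := by ring
      rw [e]
      linarith
  obtain ⟨r₀, hr₀⟩ := (isCompact_Icc (a := T - τ) (b := T)).exists_bound_of_continuousOn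
    hxc.continuousOn
  have hr₀0 : 0 ≤ r₀ := (norm_nonneg _).trans (hr₀ T ⟨by linarith, le_rfl⟩)
  have iter : ∀ k : ℕ, ∀ u, -τ ≤ u → u ≤ 0 →
      ‖x (u + (T + k * h))‖ ≤ (1 / 2) ^ k * r₀ + 2 * (C * η) := by
    intro k
    induction k with
    | zero =>
      intro u h1 h2
      have := hr₀ (u + T) ⟨by linarith, by linarith⟩
      have : 0 < C * η := by positivity
      simp only [Nat.cast_zero, zero_mul, add_zero, pow_zero, one_mul]
      linarith
    | succ k ih =>
      intro u h1 h2
      have hk : 0 ≤ (k : ℝ) * h := by positivity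
      have := (step (T + k * h) (by linarith) _ (by positivity) ih).2 u h1 h2
      have e : u + (T + (k + 1 : ℕ) * h) = u + (T + k * h + h) := by push_cast; ring
      rw [e, pow_succ]
      linarith
  have hlim : Tendsto (fun k : ℕ => (1 / 2 : ℝ) ^ k * r₀) atTop (nhds 0) := by
    simpa using (tendsto_pow_atTop_nhds_zero_of_lt_one (r := (1 / 2 : ℝ)) (by norm_num)
      (by norm_num)).mul_const r₀
  obtain ⟨k₀, hk₀⟩ := eventually_atTop.1 (hlim.eventually_lt_const (u := C * η)
    (by positivity))
  refine ⟨T + k₀ * h, fun t ht => ?_⟩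
  have hq : 0 ≤ (t - T) / h := by
    have : 0 ≤ (k₀ : ℝ) * h := by positivity
    apply div_nonneg <;> linarith
  set k := ⌊(t - T) / h⌋₊ with hk
  have hk1 : (k : ℝ) * h ≤ t - T := by
    rw [← le_div_iff₀ hh]; exact Nat.floor_le hq
  have hk2 : t - T < (k + 1 : ℝ) * h := by
    rw [← div_lt_iff₀ hh]; exact Nat.lt_floor_add_one _
  have hkk : k₀ ≤ k := by
    apply Nat.le_floor
    rw [le_div_iff₀ hh]; linarith
  have hk0 : 0 ≤ (k : ℝ) * h := by positivity
  have fin := (step (T + k * h) (by linarith) (3 * (C * η)) (by positivity) (by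
    intro u h1 h2
    have := iter k u h1 h2
    have := hk₀ k hkk
    linarith)).1 (t - (T + k * h)) (by linarith) (by linarith)
  rw [sub_add_cancel] at fin
  rw [dist_zero_right]
  have e : M * (3 * (C * η)) + C * η = ε / 2 := by
    rw [hη]; field_simp
  linarith

lemma isSol_of_hasDerivAt [CompleteSpace E] (P Q : E →L[ℝ] E) {τ : ℝ} {f x : ℝ → E}
    (hf : Continuous f) (hx : Continuous x)
    (h : ∀ t, 0 ≤ t → HasDerivAt x (P (x t) + Q (x (t - τ)) + f t) t) : IsSol P Q τ f x := by
  refine ⟨hx, fun t ht => ?_⟩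
  have c1 : Continuous (fun s => P (x s) + Q (x (s - τ)) + f s) := by fun_prop
  rw [intervalIntegral.integral_eq_sub_of_hasDerivAt (f := x) _ (c1.intervalIntegrable _ _)]
  · abel
  · intro s hs
    rw [Set.uIcc_of_le ht] at hs
    exact h s hs.1

section act
variable {G : Type*} [NormedAddCommGroup G] [NormedSpace ℂ G] {N : ℕ}

/-- action of a matrix on a tuple of vectors -/
def act (F : Matrix (Fin N) (Fin N) ℂ) (z : Fin N → G) : Fin N → G :=
  fun i => ∑ j, F i j • z j

lemma act_mul (F H : Matrix (Fin N) (Fin N) ℂ) (z : Fin N → G) :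
    act (F * H) z = act F (act H z) := by
  ext i
  simp only [act, Matrix.mul_apply, Finset.sum_smul, Finset.smul_sum, mul_smul]
  rw [Finset.sum_comm]

lemma act_one (z : Fin N → G) : act (1 : Matrix (Fin N) (Fin N) ℂ) z = z := by
  ext i
  simp [act, Matrix.one_apply]

lemma act_sub (F H : Matrix (Fin N) (Fin N) ℂ) (z : Fin N → G) :
    act (F - H) z = act F z - act H z := by
  ext i
  simp [act, sub_smul]

lemma act_smul (c : ℂ) (H : Matrix (Fin N) (Fin N) ℂ) (z : Fin N → G) :
    act (c • H) z = c • act H z := by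
  ext i
  simp [act, mul_smul, Finset.smul_sum]

lemma act_zero (z : Fin N → G) : act (0 : Matrix (Fin N) (Fin N) ℂ) z = 0 := by
  ext i
  simp [act]

lemma continuous_act (F : Matrix (Fin N) (Fin N) ℂ) : 
    Continuous (act F : (Fin N → G) → (Fin N → G)) := by
  unfold act
  fun_prop

lemma act_map (F : Matrix (Fin N) (Fin N) ℂ) (P : G →L[ℂ] G) (z : Fin N → G) (i : Fin N) :
    P (act F z i) = act F (fun j => P (z j)) i := by
  simp [act]

lemma multi_decay [FiniteDimensional ℂ G] (P D : G →L[ℂ] G) {τ : ℝ} (hτ : 0 ≤ τ)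
    (F : Matrix (Fin N) (Fin N) ℂ) (l : List ℂ)
    (H : ∀ lam ∈ l, ∀ x : ℝ → G, ContDiff ℝ 1 x →
      (∀ t : ℝ, 0 ≤ t → HasDerivAt x (P (x t) - lam • D (x (t - τ))) t) →
      Tendsto x atTop (nhds 0))
    (z : ℝ → Fin N → G) (hz : Continuous z)
    (hd : ∀ i t, 0 ≤ t → HasDerivAt (fun t => z t i)
      (P (z t i) - D (act F (z (t - τ)) i)) t)
    (h0 : Tendsto (fun t => act (l.map fun lam => F - lam • 1).prod (z t)) atTop (nhds 0)) :
    Tendsto z atTop (nhds 0) := by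
  have : FiniteDimensional ℝ G := FiniteDimensional.complexToReal G
  have : CompleteSpace G := FiniteDimensional.complete ℂ G
  induction l with
  | nil => simpa [act_one] using h0
  | cons lam l ih =>
    apply ih (fun mu hmu => H mu (List.mem_cons_of_mem _ hmu))
    set M := (l.map fun lam => F - lam • (1 : Matrix (Fin N) (Fin N) ℂ)).prod with hM
    have hcomm : Commute F M := by
      apply Commute.list_prod_right
      intro y hy
      obtain ⟨mu, _, rfl⟩ := List.mem_map.1 hy
      exact (Commute.refl F).sub_right ((Commute.one_right F).smul_right mu)
    simp only [List.map_cons, List.prod_cons, ← hM, act_mul] at h0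
    have hwc : Continuous (fun t => act M (z t)) := (continuous_act M).comp hz
    rw [tendsto_pi_nhds]
    intro i
    have hwd : ∀ t, 0 ≤ t → HasDerivAt (fun t => act M (z t) i)
        (P (act M (z t) i) - D (act F (act M (z (t - τ))) i)) t := by
      intro t ht
      have h1 : HasDerivAt (fun t => act M (z t) i)
          (∑ j, M i j • (P (z t j) - D (act F (z (t - τ)) j))) t := by
        unfold act
        exact HasDerivAt.fun_sum fun j _ => (hd j t ht).const_smul (M i j)
      convert h1 using 1
      rw [← act_mul, hcomm.eq, act_mul, act_map, act_map]
      simp only [act, smul_sub, Finset.sum_sub_distrib]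
    let Q : G →L[ℝ] G := (-(lam • D)).restrictScalars ℝ
    let f : ℝ → G := fun t => -(D (act (F - lam • 1) (act M (z (t - τ))) i))
    have hc2 : Continuous (fun t => act (F - lam • 1) (act M (z (t - τ))) i) :=
      (continuous_apply i).comp ((continuous_act _).comp
        (hwc.comp (continuous_id.sub continuous_const)))
    have hf : Continuous f := (D.continuous.comp hc2).neg
    have hf0 : Tendsto f atTop (nhds 0) := by
      have h1 := (tendsto_pi_nhds.1 h0 i).comp
        (tendsto_atTop_add_const_right atTop (-τ) tendsto_id)
      have h2 := ((D.continuous.tendsto 0).comp h1).neg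
      simpa [f, Function.comp_def, sub_eq_add_neg] using h2
    refine forced_decay (P.restrictScalars ℝ) Q hτ (mild_decay _ _ hτ ?_) hf hf0
      (isSol_of_hasDerivAt _ _ hf ((continuous_apply i).comp hwc) ?_)
    · intro x hx hx'
      refine H lam (by simp) x hx fun t ht => ?_
      convert hx' t ht using 1
      simp [Q, sub_eq_add_neg]
    · intro t ht
      convert hwd t ht using 1
      simp only [Q, f, act_sub, act_smul, act_one]
      simp
      abel

end act

lemma kron_one_mulVec {n N : ℕ} (A : Matrix (Fin n) (Fin n) ℝ) (d : Fin N × Fin n → ℝ)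
    (i : Fin N) (k : Fin n) :
    ((1 : Matrix (Fin N) (Fin N) ℝ) ⊗ₖ A).mulVec d (i, k) = ∑ l, A k l * d (i, l) := by
  simp only [Matrix.mulVec, dotProduct, Matrix.kroneckerMap_apply, Fintype.sum_prod_type]
  rw [Finset.sum_eq_single i]
  · simp
  · intro j _ hj; simp [Matrix.one_apply_ne hj.symm]
  · simp

lemma kron_mulVec {n N : ℕ} (F : Matrix (Fin N) (Fin N) ℝ) (D : Matrix (Fin n) (Fin n) ℝ)
    (d : Fin N × Fin n → ℝ) (i : Fin N) (k : Fin n) :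
    (F ⊗ₖ D).mulVec d (i, k) = ∑ j, ∑ l, F i j * D k l * d (j, l) := by
  simp only [Matrix.mulVec, dotProduct, Matrix.kroneckerMap_apply, Fintype.sum_prod_type]

lemma forward_sol {n N : ℕ} (A D : Matrix (Fin n) (Fin n) ℝ) (F : Matrix (Fin N) (Fin N) ℝ)
    {τ : ℝ} {lam : ℂ} {v : Fin N → ℂ} (hv : (F.map Complex.ofReal).mulVec v = lam • v)
    {x : ℝ → Fin n → ℂ} {t : ℝ} (hx : HasDerivAt x
          ((A.map (Complex.ofReal)).mulVec (x t)
            - lam • (D.map (Complex.ofReal)).mulVec (x (t - τ))) t) (L : ℂ →L[ℝ] ℝ) :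
    HasDerivAt (fun t (p : Fin N × Fin n) => L (v p.1 * x t p.2))
      (((1 : Matrix (Fin N) (Fin N) ℝ) ⊗ₖ A).mulVec (fun p => L (v p.1 * x t p.2))
            - (F ⊗ₖ D).mulVec (fun p => L (v p.1 * x (t - τ) p.2))) t := by
  rw [hasDerivAt_pi] at hx ⊢
  have hL : ∀ (a : ℝ) (c : ℂ), a * L c = L (a * c) := by
    intro a c
    rw [← Complex.real_smul, L.map_smul, smul_eq_mul]
  rintro ⟨i, k⟩
  have h1 := L.hasFDerivAt.comp_hasDerivAt t ((hx k).const_mul (v i))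
  refine HasDerivAt.congr_deriv (f := fun s => L (v i * x s k)) h1 (Eq.symm ?_)
  rw [Pi.sub_apply, kron_one_mulVec, kron_mulVec]
  have hvi : ∑ j, (F i j : ℂ) * v j = lam * v i := by
    have := congrFun hv i
    simpa [Matrix.mulVec, dotProduct] using this
  simp only [hL, ← map_sum, ← map_sub]
  congr 1
  simp only [Pi.sub_apply, Pi.smul_apply, smul_eq_mul, Matrix.mulVec, dotProduct, Matrix.map_apply]
  rw [mul_sub]
  congr 1
  · rw [Finset.mul_sum]; refine Finset.sum_congr rfl fun l _ => by ring
  · rw [← mul_assoc, mul_comm (v i), ← hvi, Finset.sum_mul_sum]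
    refine Finset.sum_congr rfl fun j _ => Finset.sum_congr rfl fun l _ => ?_
    push_cast; ring

lemma prod_roots_zero {N : ℕ} (F : Matrix (Fin N) (Fin N) ℂ) :
    (F.charpoly.roots.toList.map fun lam => F - lam • (1 : Matrix (Fin N) (Fin N) ℂ)).prod = 0 := by
  have h1 := (IsAlgClosed.splits F.charpoly).eq_prod_roots
  rw [F.charpoly_monic.leadingCoeff, Polynomial.C_1, one_mul] at h1
  have h2 := Matrix.aeval_self_charpoly F
  rw [h1, ← Multiset.coe_toList F.charpoly.roots, Multiset.map_coe, Multiset.prod_coe, map_list_prod,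
    List.map_map] at h2
  rw [← h2]
  congr 1
  refine List.map_congr_left fun lam _ => ?_
  simp [Algebra.algebraMap_eq_smul_one]

end DDE


/-- **Decomposition of the global synchronization error dynamics** (Lemma 2 of the paper).
The trivial solution of `δ̇(t) = (I_N ⊗ A) δ(t) − (F ⊗ BK) δ(t−τ)` is asymptotically
stable (every solution tends to `0`) if and only if, for every complex eigenvalue `λ` of
`F`, the trivial solution of `ẋ(t) = A x(t) − λ BK x(t−τ)` is asymptotically stable. -/
theorem global_error_stable_iff_modal_stable {n m N : ℕ}
    (A : Matrix (Fin n) (Fin n) ℝ) (B : Matrix (Fin n) (Fin m) ℝ)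
    (K : Matrix (Fin m) (Fin n) ℝ) (F : Matrix (Fin N) (Fin N) ℝ)
    (τ : ℝ) (hτ : 0 ≤ τ) :
    (∀ δ : ℝ → (Fin N × Fin n → ℝ), ContDiff ℝ 1 δ →
        (∀ t : ℝ, 0 ≤ t → HasDerivAt δ
          (((1 : Matrix (Fin N) (Fin N) ℝ) ⊗ₖ A).mulVec (δ t)
            - (F ⊗ₖ (B * K)).mulVec (δ (t - τ))) t) →
        Tendsto δ atTop (nhds 0))
    ↔
    (∀ lam ∈ spectrum ℂ (F.map (Complex.ofReal)),
      ∀ x : ℝ → (Fin n → ℂ), ContDiff ℝ 1 x →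
        (∀ t : ℝ, 0 ≤ t → HasDerivAt x
          ((A.map (Complex.ofReal)).mulVec (x t)
            - lam • ((B * K).map (Complex.ofReal)).mulVec (x (t - τ))) t) →
        Tendsto x atTop (nhds 0)) := by
  constructor
  · intro H lam hlam x hx hxd
    rw [← Matrix.spectrum_toLin', ← Module.End.hasEigenvalue_iff_mem_spectrum] at hlam
    obtain ⟨v, hv⟩ := hlam.exists_hasEigenvector
    have hv1 : (F.map Complex.ofReal).mulVec v = lam • v := by
      simpa using hv.apply_eq_smul
    obtain ⟨i, hi⟩ := Function.ne_iff.1 hv.2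
    have key : ∀ L : ℂ →L[ℝ] ℝ, Tendsto (fun t (p : Fin N × Fin n) => L (v p.1 * x t p.2))
        atTop (nhds 0) := by
      intro L
      apply H
      · rw [contDiff_pi] at hx ⊢
        rintro ⟨j, k⟩
        exact L.contDiff.comp (contDiff_const.mul (hx k))
      · intro t ht
        exact DDE.forward_sol A (B * K) F hv1 (hxd t ht) L
    rw [tendsto_pi_nhds]
    intro k
    have h1 := tendsto_pi_nhds.1 (key Complex.reCLM) (i, k)
    have h2 := tendsto_pi_nhds.1 (key Complex.imCLM) (i, k)
    have h3 : Tendsto (fun t => v i * x t k) atTop (nhds 0) := by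
      have h4 := ((Complex.continuous_ofReal.tendsto 0).comp h1).add
        (((Complex.continuous_ofReal.tendsto 0).comp h2).mul_const Complex.I)
      refine (h4.congr fun t => ?_).trans (by simp)
      exact Complex.re_add_im _
    have h5 := h3.const_mul (v i)⁻¹
    simp only [Pi.zero_apply] at hi
    simpa [inv_mul_cancel_left₀ hi] using h5
  · intro H δ hδ hδd
    let P : (Fin n → ℂ) →L[ℂ] (Fin n → ℂ) :=
      (A.map Complex.ofReal).mulVecLin.toContinuousLinearMap
    let D : (Fin n → ℂ) →L[ℂ] (Fin n → ℂ) :=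
      ((B * K).map Complex.ofReal).mulVecLin.toContinuousLinearMap
    let z : ℝ → Fin N → Fin n → ℂ := fun t i k => (δ t (i, k) : ℂ)
    have hδc := hδ.continuous
    have hz : Continuous z := by
      refine continuous_pi fun i => continuous_pi fun k => ?_
      exact Complex.continuous_ofReal.comp ((continuous_apply (i, k)).comp hδc)
    have hzt : Tendsto z atTop (nhds 0) := by
      refine DDE.multi_decay P D hτ (F.map Complex.ofReal)
        (F.map Complex.ofReal).charpoly.roots.toList ?_ z hz ?_ ?_
      · intro lam hlam x hx hxd
        rw [Multiset.mem_toList] at hlam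
        exact H lam (Matrix.mem_spectrum_iff_isRoot_charpoly.2 (Polynomial.isRoot_of_mem_roots hlam))
          x hx hxd
      · intro i t ht
        rw [hasDerivAt_pi]
        intro k
        have h1 := (hasDerivAt_pi.1 (hδd t ht) (i, k)).ofReal_comp
        refine HasDerivAt.congr_deriv h1 (Eq.symm ?_)
        rw [Pi.sub_apply, Pi.sub_apply, DDE.kron_one_mulVec, DDE.kron_mulVec, DDE.act_map]
        simp only [P, D, DDE.act, z, Matrix.mulVec, dotProduct, Pi.sub_apply, Finset.sum_apply,
          LinearMap.coe_toContinuousLinearMap', Matrix.mulVecLin_apply, Matrix.map_apply,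
          Pi.smul_apply, smul_eq_mul, Finset.mul_sum]
        push_cast
        simp only [mul_assoc]
      · simp only [DDE.prod_roots_zero, DDE.act_zero]
        exact tendsto_const_nhds
    rw [tendsto_pi_nhds]
    rintro ⟨i, k⟩
    have h1 := tendsto_pi_nhds.1 (tendsto_pi_nhds.1 hzt i) k
    have h2 := (Complex.continuous_re.tendsto 0).comp h1
    simpa [z, Function.comp_def] using h2
end

section
/- Let A, A_d ∈ ℝ^{n×n}, h ≥ 0, and σ ∈ ℂ. Suppose there exist real symmetric positive definite n×n matrices P, S, R such that the 3n×3n complex block matrix M(σ, h; P, S, R) with blocks M₁₁ = AᵀP + PA + S − R, M₁₂ = σ P A_d + R, M₁₃ = h Aᵀ R, M₂₂ = −S − R, M₂₃ = σ* h A_dᵀ R, M₃₃ = −R (and remaining blocks determined by Hermitian symmetry) is negative definite. Then for every delay τ ∈ [0, h], every solution x : ℝ → ℂⁿ of the complex retarded functional differential equation ẋ(t) = A x(t) + σ A_d x(t−τ) tends to 0 as t → ∞. -/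
open Matrix Filter

/-- A complex square matrix is negative definite: Hermitian with
`zᴴ M z < 0` for every nonzero complex vector `z`. -/
def Matrix.NegDefC {k : Type*} [Fintype k] (M : Matrix k k ℂ) : Prop :=
  M.IsHermitian ∧ ∀ z : k → ℂ, z ≠ 0 → (star z ⬝ᵥ M.mulVec z).re < 0

/-- The `3n × 3n` Hermitian block matrix determined by its upper-triangular blocks. -/
def Matrix.herm3 {n : ℕ} (M11 M12 M13 M22 M23 M33 : Matrix (Fin n) (Fin n) ℂ) :
    Matrix (Fin 3 × Fin n) (Fin 3 × Fin n) ℂ :=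
  fun p q => ![![M11, M12, M13], ![M12ᴴ, M22, M23], ![M13ᴴ, M23ᴴ, M33]] p.1 q.1 p.2 q.2

/-- The LMI matrix (12) of the paper. -/
noncomputable def lmiMatrix {n : ℕ} (A Ad : Matrix (Fin n) (Fin n) ℝ) (σ : ℂ) (h : ℝ)
    (P S R : Matrix (Fin n) (Fin n) ℝ) :
    Matrix (Fin 3 × Fin n) (Fin 3 × Fin n) ℂ :=
  let Ac := A.map (Complex.ofReal)
  let Adc := Ad.map (Complex.ofReal)
  let Pc := P.map (Complex.ofReal)
  let Sc := S.map (Complex.ofReal)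
  let Rc := R.map (Complex.ofReal)
  Matrix.herm3
    (Acᵀ * Pc + Pc * Ac + Sc - Rc)          -- M₁₁
    (σ • (Pc * Adc) + Rc)                   -- M₁₂
    ((h : ℂ) • (Acᵀ * Rc))                  -- M₁₃
    (-Sc - Rc)                              -- M₂₂
    ((starRingEnd ℂ σ) • (h : ℂ) • (Adcᵀ * Rc)) -- M₂₃
    (-Rc)                                   -- M₃₃


/-- The real part of the sesquilinear form of a matrix. -/
noncomputable def BB {n : ℕ} (M : Matrix (Fin n) (Fin n) ℂ) (u v : Fin n → ℂ) : ℝ :=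
  (star u ⬝ᵥ M *ᵥ v).re

lemma BB_add_left {n : ℕ} (M : Matrix (Fin n) (Fin n) ℂ) (u u' v : Fin n → ℂ) :
    BB M (u + u') v = BB M u v + BB M u' v := by
  simp [BB, add_dotProduct]

lemma BB_add_right {n : ℕ} (M : Matrix (Fin n) (Fin n) ℂ) (u v v' : Fin n → ℂ) :
    BB M u (v + v') = BB M u v + BB M u v' := by
  simp [BB, mulVec_add, dotProduct_add]

lemma BB_sub_left {n : ℕ} (M : Matrix (Fin n) (Fin n) ℂ) (u u' v : Fin n → ℂ) :
    BB M (u - u') v = BB M u v - BB M u' v := by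
  simp [BB, sub_dotProduct]

lemma BB_sub_right {n : ℕ} (M : Matrix (Fin n) (Fin n) ℂ) (u v v' : Fin n → ℂ) :
    BB M u (v - v') = BB M u v - BB M u v' := by
  simp [BB, mulVec_sub, dotProduct_sub]

lemma BB_smul_right {n : ℕ} (M : Matrix (Fin n) (Fin n) ℂ) (c : ℝ) (u v : Fin n → ℂ) :
    BB M u ((c : ℂ) • v) = c * BB M u v := by
  simp [BB, mulVec_smul, dotProduct_smul]

lemma BB_smul_left {n : ℕ} (M : Matrix (Fin n) (Fin n) ℂ) (c : ℝ) (u v : Fin n → ℂ) :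
    BB M ((c : ℂ) • u) v = c * BB M u v := by
  simp [BB, star_smul, smul_dotProduct]

lemma star_dotProduct_star_aux {n : ℕ} (v w : Fin n → ℂ) :
    star (star v ⬝ᵥ w) = star w ⬝ᵥ v := by
  simp [dotProduct, mul_comm]

lemma BB_conjTranspose {n : ℕ} (M : Matrix (Fin n) (Fin n) ℂ) (u v : Fin n → ℂ) :
    BB Mᴴ u v = BB M v u := by
  unfold BB
  have : star u ⬝ᵥ Mᴴ *ᵥ v = star (star v ⬝ᵥ M *ᵥ u) := by
    rw [star_dotProduct_star_aux, star_mulVec, dotProduct_mulVec]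
  rw [this]
  simp

lemma BB_symm {n : ℕ} {M : Matrix (Fin n) (Fin n) ℂ} (hM : M.IsHermitian) (u v : Fin n → ℂ) :
    BB M u v = BB M v u := by
  conv_lhs => rw [← hM]
  exact BB_conjTranspose M u v

lemma map_herm {n : ℕ} {P : Matrix (Fin n) (Fin n) ℝ} (hP : P.IsHermitian) :
    (P.map Complex.ofReal).IsHermitian := by
  ext i j
  have := congrFun (congrFun hP i) j
  simp at this
  simp [this]

lemma BB_nonneg {n : ℕ} {P : Matrix (Fin n) (Fin n) ℝ} (hP : P.PosDef) (v : Fin n → ℂ) :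
    0 ≤ BB (P.map Complex.ofReal) v v := by
  have h1 : BB (P.map Complex.ofReal) v v =
      (fun i => (v i).re) ⬝ᵥ P *ᵥ (fun i => (v i).re)
      + (fun i => (v i).im) ⬝ᵥ P *ᵥ (fun i => (v i).im) := by
    simp [BB, dotProduct, mulVec]
    rw [← Finset.sum_add_distrib]
    
  rw [h1]
  have a := hP.posSemidef.dotProduct_mulVec_nonneg (fun i => (v i).re)
  have b := hP.posSemidef.dotProduct_mulVec_nonneg (fun i => (v i).im)
  simp only [star_trivial] at a b
  linarith

lemma BB_hasDerivAt {n : ℕ} (M : Matrix (Fin n) (Fin n) ℂ) {u v : ℝ → Fin n → ℂ}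
    {u' v' : Fin n → ℂ} {t : ℝ} (hu : HasDerivAt u u' t) (hv : HasDerivAt v v' t) :
    HasDerivAt (fun s => BB M (u s) (v s)) (BB M u' (v t) + BB M (u t) v') t := by
  have hu' := hasDerivAt_pi.1 hu
  have hv' := hasDerivAt_pi.1 hv
  have key : HasDerivAt (fun s => star (u s) ⬝ᵥ M *ᵥ v s)
      (∑ i, (star (u' i) * (∑ j, M i j * v t j) + star (u t i) * (∑ j, M i j * v' j))) t := by
    simp only [dotProduct, mulVec]
    apply HasDerivAt.fun_sum
    intro i _
    apply HasDerivAt.mul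
    · exact (hu' i).star
    · apply HasDerivAt.fun_sum
      intro j _
      exact (hv' j).const_mul _
  have := Complex.reCLM.hasFDerivAt.comp_hasDerivAt t key
  refine HasDerivAt.congr_deriv this ?_
  rw [Finset.sum_add_distrib]
  simp [BB, dotProduct, mulVec]

lemma BB_continuous {n : ℕ} (M : Matrix (Fin n) (Fin n) ℂ) {u v : ℝ → Fin n → ℂ}
    (hu : Continuous u) (hv : Continuous v) : Continuous (fun s => BB M (u s) (v s)) := by
  have hu' := continuous_pi_iff.1 hu
  have hv' := continuous_pi_iff.1 hv
  simp only [BB, dotProduct, mulVec, Pi.star_apply]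
  fun_prop

lemma mono_le {f f' : ℝ → ℝ} {a b : ℝ} (hab : a ≤ b)
    (hf : ∀ s ∈ Set.Icc a b, HasDerivAt f (f' s) s) (h0 : ∀ s ∈ Set.Icc a b, 0 ≤ f' s) :
    f a ≤ f b := by
  have : MonotoneOn f (Set.Icc a b) := by
    apply monotoneOn_of_deriv_nonneg (convex_Icc a b)
    · exact fun s hs => (hf s hs).continuousAt.continuousWithinAt
    · exact fun s hs => (hf s (interior_subset hs)).differentiableAt.differentiableWithinAt
    · intro s hs
      rw [(hf s (interior_subset hs)).deriv]
      exact h0 s (interior_subset hs)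
  exact this ⟨le_rfl, hab⟩ ⟨hab, le_rfl⟩ hab

/-- Quadratic form bound by compactness. -/
lemma negdef_bound {k : Type*} [Fintype k] {M : Matrix k k ℂ} (hM : M.NegDefC) :
    ∃ ε > 0, ∀ z : k → ℂ, (star z ⬝ᵥ M.mulVec z).re ≤ -ε * ‖z‖ ^ 2 := by
  have hc : Continuous (fun z : k → ℂ => (star z ⬝ᵥ M.mulVec z).re) := by
    simp only [dotProduct, mulVec, Pi.star_apply]
    fun_prop
  have hsc : ∀ (c : ℝ) (z : k → ℂ), (star ((c:ℂ) • z) ⬝ᵥ M.mulVec ((c:ℂ) • z)).re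
      = c ^ 2 * (star z ⬝ᵥ M.mulVec z).re := by
    intro c z
    simp [mulVec_smul, star_smul]
    ring
  by_cases hne : (Metric.sphere (0 : k → ℂ) 1).Nonempty
  · obtain ⟨z0, hz0, hmax⟩ := (isCompact_sphere (0 : k → ℂ) 1).exists_isMaxOn hne hc.continuousOn
    have hz0' : z0 ≠ 0 := by
      rintro rfl
      simp at hz0
    refine ⟨-(star z0 ⬝ᵥ M.mulVec z0).re, by have := hM.2 z0 hz0'; linarith, ?_⟩
    intro z
    by_cases hz : z = 0
    · simp [hz]
    have hn : ‖z‖ ≠ 0 := norm_ne_zero_iff.2 hz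
    have h1 : ((‖z‖⁻¹ : ℝ) : ℂ) • z ∈ Metric.sphere (0 : k → ℂ) 1 := by
      simp [norm_smul, hn]
    have h2 := hmax h1
    simp only [Set.mem_ofPred_eq] at h2
    rw [hsc] at h2
    have h3 := mul_le_mul_of_nonneg_left h2 (sq_nonneg ‖z‖)
    rw [← mul_assoc, ← mul_pow, mul_inv_cancel₀ hn] at h3
    linarith
  · refine ⟨1, one_pos, ?_⟩
    intro z
    by_cases hz : z = 0
    · simp [hz]
    exfalso
    have hn : ‖z‖ ≠ 0 := norm_ne_zero_iff.2 hz
    exact hne ⟨((‖z‖⁻¹ : ℝ) : ℂ) • z, by simp [norm_smul, hn]⟩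

lemma herm3_form {n : ℕ} (M11 M12 M13 M22 M23 M33 : Matrix (Fin n) (Fin n) ℂ)
    (x y w : Fin n → ℂ) :
    (star (fun p : Fin 3 × Fin n => ![x, y, w] p.1 p.2) ⬝ᵥ
      (Matrix.herm3 M11 M12 M13 M22 M23 M33).mulVec
        (fun p : Fin 3 × Fin n => ![x, y, w] p.1 p.2)).re
    = BB M11 x x + 2 * BB M12 x y + 2 * BB M13 x w + BB M22 y y + 2 * BB M23 y w
      + BB M33 w w := by
  have : (star (fun p : Fin 3 × Fin n => ![x, y, w] p.1 p.2) ⬝ᵥ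
      (Matrix.herm3 M11 M12 M13 M22 M23 M33).mulVec
        (fun p : Fin 3 × Fin n => ![x, y, w] p.1 p.2)).re
      = BB M11 x x + BB M12 x y + BB M13 x w + (BB M12ᴴ y x + BB M22 y y + BB M23 y w)
       + (BB M13ᴴ w x + BB M23ᴴ w y + BB M33 w w) := by
    simp only [BB, ← Complex.add_re, ← dotProduct_add]
    congr 1
    have hm : ∀ (a : Fin 3) (i : Fin n), (Matrix.herm3 M11 M12 M13 M22 M23 M33).mulVec
        (fun p : Fin 3 × Fin n => ![x, y, w] p.1 p.2) (a, i)
        = (∑ j, Matrix.herm3 M11 M12 M13 M22 M23 M33 (a, i) (0, j) * x j)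
        + (∑ j, Matrix.herm3 M11 M12 M13 M22 M23 M33 (a, i) (1, j) * y j)
        + (∑ j, Matrix.herm3 M11 M12 M13 M22 M23 M33 (a, i) (2, j) * w j) := by
      intro a i
      rw [mulVec, dotProduct, Fintype.sum_prod_type, Fin.sum_univ_three]
      rfl
    rw [dotProduct, Fintype.sum_prod_type, Fin.sum_univ_three]
    refine congrArg₂ (· + ·) (congrArg₂ (· + ·) ?_ ?_) ?_ <;>
    · refine Finset.sum_congr rfl fun i _ => ?_
      rw [hm]
      rfl
  rw [this, BB_conjTranspose, BB_conjTranspose, BB_conjTranspose]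
  ring

lemma BB_mat_add {n : ℕ} (M N : Matrix (Fin n) (Fin n) ℂ) (u v : Fin n → ℂ) :
    BB (M + N) u v = BB M u v + BB N u v := by
  simp [BB, add_mulVec]

lemma BB_mat_sub {n : ℕ} (M N : Matrix (Fin n) (Fin n) ℂ) (u v : Fin n → ℂ) :
    BB (M - N) u v = BB M u v - BB N u v := by
  simp [BB, sub_mulVec]

lemma BB_mat_neg {n : ℕ} (M : Matrix (Fin n) (Fin n) ℂ) (u v : Fin n → ℂ) :
    BB (-M) u v = - BB M u v := by
  simp [BB, neg_mulVec]

lemma BB_mul_right {n : ℕ} (M N : Matrix (Fin n) (Fin n) ℂ) (u v : Fin n → ℂ) :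
    BB (M * N) u v = BB M u (N *ᵥ v) := by
  simp [BB]

lemma BB_mul_left {n : ℕ} (M N : Matrix (Fin n) (Fin n) ℂ) (u v : Fin n → ℂ) :
    BB (Mᴴ * N) u v = BB N (M *ᵥ u) v := by
  simp only [BB, ← mulVec_mulVec]
  rw [dotProduct_mulVec, star_mulVec]

lemma map_transpose_eq {n : ℕ} (A : Matrix (Fin n) (Fin n) ℝ) :
    (A.map Complex.ofReal)ᵀ = (A.map Complex.ofReal)ᴴ := by
  ext i j
  simp

lemma lmi_form {n : ℕ} (A Ad : Matrix (Fin n) (Fin n) ℝ) (σ : ℂ) (h : ℝ)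
    {P S R : Matrix (Fin n) (Fin n) ℝ} (hP : P.PosDef) (hR : R.PosDef)
    (x y f : Fin n → ℂ)
    (hf : f = (A.map Complex.ofReal) *ᵥ x + σ • (Ad.map Complex.ofReal) *ᵥ y) :
    (star (fun p : Fin 3 × Fin n => ![x, y, (h : ℂ) • f] p.1 p.2) ⬝ᵥ
      (lmiMatrix A Ad σ h P S R).mulVec
        (fun p : Fin 3 × Fin n => ![x, y, (h : ℂ) • f] p.1 p.2)).re
    = 2 * BB (P.map Complex.ofReal) x f + BB (S.map Complex.ofReal) x x
      - BB (S.map Complex.ofReal) y y - BB (R.map Complex.ofReal) (x - y) (x - y)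
      + h ^ 2 * BB (R.map Complex.ofReal) f f := by
  unfold lmiMatrix
  simp only
  rw [herm3_form]
  have hPs := BB_symm (map_herm hP.1)
  have hRs := BB_symm (map_herm hR.1)
  have e1 : σ • (P.map Complex.ofReal * Ad.map Complex.ofReal)
      = P.map Complex.ofReal * (σ • Ad.map Complex.ofReal) := by simp
  have e2 : (starRingEnd ℂ σ) • (h : ℂ) • ((Ad.map Complex.ofReal)ᵀ * R.map Complex.ofReal)
      = (σ • Ad.map Complex.ofReal)ᴴ * ((h : ℂ) • R.map Complex.ofReal) := by
    rw [map_transpose_eq, conjTranspose_smul]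
    simp
    rw [smul_comm]
  have e3 : (h : ℂ) • ((A.map Complex.ofReal)ᵀ * R.map Complex.ofReal)
      = (A.map Complex.ofReal)ᴴ * ((h : ℂ) • R.map Complex.ofReal) := by
    rw [map_transpose_eq]
    simp
  have e4 : ∀ u v, BB ((h : ℂ) • R.map Complex.ofReal) u v
      = h * BB (R.map Complex.ofReal) u v := by
    intro u v
    simp [BB, smul_mulVec]
  rw [e1, e2, e3, map_transpose_eq]
  simp only [BB_mat_add, BB_mat_sub, BB_mat_neg, BB_mul_left]
  simp only [BB_mul_right, e4, BB_smul_left,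
    BB_smul_right, BB_sub_left, BB_sub_right]
  rw [hRs y x, hPs (A.map Complex.ofReal *ᵥ x) x]
  have hf' : f = (A.map Complex.ofReal) *ᵥ x + (σ • Ad.map Complex.ofReal) *ᵥ y := by
    rw [hf, smul_mulVec]
  generalize (A.map Complex.ofReal) *ᵥ x = a at *
  generalize (σ • Ad.map Complex.ofReal) *ᵥ y = b at *
  have e5 : BB (R.map Complex.ofReal) f f
    = BB (R.map Complex.ofReal) a f + BB (R.map Complex.ofReal) b f := by
    rw [← BB_add_left, ← hf']
  have e6 : BB (P.map Complex.ofReal) x f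
    = BB (P.map Complex.ofReal) x a + BB (P.map Complex.ofReal) x b := by
    rw [← BB_add_right, ← hf']
  rw [e5, e6]
  ring

lemma jensen {n : ℕ} {R : Matrix (Fin n) (Fin n) ℝ} (hR : R.PosDef)
    {x x' : ℝ → Fin n → ℂ} (hx : ∀ t, HasDerivAt x (x' t) t) {G : ℝ → ℝ}
    (hG : ∀ t, HasDerivAt G (BB (R.map Complex.ofReal) (x' t) (x' t)) t) {τ : ℝ} (hτ : 0 ≤ τ)
    (t : ℝ) :
    BB (R.map Complex.ofReal) (x t - x (t - τ)) (x t - x (t - τ)) ≤ τ * (G t - G (t - τ)) := by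
  set Rc := R.map Complex.ofReal
  have hRs := BB_symm (map_herm hR.1)
  rcases hτ.eq_or_lt with h0 | h0
  · subst h0
    simp [BB]
  set D := x t - x (t - τ) with hD
  set c : Fin n → ℂ := ((τ⁻¹ : ℝ) : ℂ) • D with hc
  have key := mono_le (f := fun s => G s - 2 * BB Rc c (x s) + s * BB Rc c c)
    (f' := fun s => BB Rc (x' s - c) (x' s - c)) (a := t - τ) (b := t) (by linarith)
    (by
      intro s _
      have h1 := BB_hasDerivAt Rc (hasDerivAt_const s c) (hx s)
      have := ((hG s).sub (h1.const_mul 2)).add ((hasDerivAt_id s).mul_const (BB Rc c c))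
      refine HasDerivAt.congr_deriv this ?_
      simp only [BB_sub_left, BB_sub_right]
      rw [hRs (x' s) c]
      simp [BB]
      ring)
    (fun s _ => BB_nonneg hR _)
  have e1 : BB Rc c (x t) - BB Rc c (x (t - τ)) = τ⁻¹ * BB Rc D D := by
    rw [← BB_sub_right, ← hD, hc, BB_smul_left]
  have e2 : BB Rc c c = τ⁻¹ * (τ⁻¹ * BB Rc D D) := by
    rw [hc, BB_smul_left, BB_smul_right]
  have e3 : τ⁻¹ * BB Rc D D ≤ G t - G (t - τ) := by
    have : τ * BB Rc c c = τ⁻¹ * BB Rc D D := by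
      rw [e2, ← mul_assoc, mul_inv_cancel₀ h0.ne', one_mul]
    nlinarith
  have := mul_le_mul_of_nonneg_left e3 hτ
  rwa [← mul_assoc, mul_inv_cancel₀ h0.ne', one_mul] at this

lemma prim {f : ℝ → ℝ} (hf : Continuous f) : ∃ F : ℝ → ℝ, F 0 = 0 ∧ (∀ t, F t = ∫ s in (0:ℝ)..t, f s)
    ∧ ∀ t, HasDerivAt F (f t) t :=
  ⟨fun t => ∫ s in (0:ℝ)..t, f s, by simp, fun _ => rfl,
    fun t => (hf.integral_hasStrictDerivAt 0 t).hasDerivAt⟩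

lemma final_step {n : ℕ} {x : ℝ → Fin n → ℂ} (hx : ContDiff ℝ 1 x) {τ C : ℝ} (hτ : 0 ≤ τ)
    (hC : 0 ≤ C)
    (hb : ∀ t, 0 ≤ t → ‖deriv x t‖ ≤ C * ‖x t‖ + C * ‖x (t - τ)‖) {K : ℝ}
    (hK : ∀ T, 0 ≤ T → ∫ s in (0:ℝ)..T, ‖x s‖ ^ 2 ≤ K) : Tendsto x atTop (nhds 0) := by
  have hcx : Continuous x := hx.continuous
  have hcx' : Continuous (deriv x) := hx.continuous_deriv le_rfl
  have hd : ∀ t, HasDerivAt x (deriv x t) t := fun t =>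
    (hx.differentiable one_ne_zero t).hasDerivAt
  have hI0 : MeasureTheory.IntegrableOn (fun s => ‖x s‖ ^ 2) (Set.Ioi 0) := by
    apply MeasureTheory.integrableOn_Ioi_of_intervalIntegral_norm_bounded K 0
      (l := atTop) (b := id) _ tendsto_id
    · filter_upwards [eventually_ge_atTop 0] with T hT
      simpa using hK T hT
    · intro T
      exact (hcx.norm.pow 2).integrableOn_Ioc
  have hI1 : MeasureTheory.IntegrableOn (fun s => ‖x s‖ ^ 2) (Set.Ioi (-τ)) := by
    have : Set.Ioi (-τ) = Set.Ioc (-τ) 0 ∪ Set.Ioi 0 :=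
      (Set.Ioc_union_Ioi_eq_Ioi (by linarith)).symm
    rw [this]
    exact ((hcx.norm.pow 2).integrableOn_Ioc).union hI0
  have hI2 : MeasureTheory.IntegrableOn (fun s => ‖x (s - τ)‖ ^ 2) (Set.Ioi 0) := by
    have hmp := MeasureTheory.measurePreserving_sub_right (MeasureTheory.volume : MeasureTheory.Measure ℝ) τ
    have := (hmp.integrableOn_comp_preimage (MeasurableEquiv.subRight τ).measurableEmbedding
      (f := fun s => ‖x s‖ ^ 2) (s := Set.Ioi (-τ))).2 hI1
    simpa [Function.comp_def] using this
  rw [tendsto_pi_nhds]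
  intro i
  have hdi : ∀ t, HasDerivAt (fun s => x s i) (deriv x t i) t := fun t => hasDerivAt_pi.1 (hd t) i
  have hg : ∀ t, HasDerivAt (fun s => ‖x s i‖ ^ 2) (2 * inner ℝ (x t i) (deriv x t i)) t :=
    fun t => (hdi t).norm_sq
  have hci : Continuous fun s => x s i := (continuous_apply i).comp hcx
  have hci' : Continuous fun s => deriv x s i := (continuous_apply i).comp hcx'
  have hlim := MeasureTheory.tendsto_zero_of_hasDerivAt_of_integrableOn_Ioi (a := 0)
    (f := fun s => ‖x s i‖ ^ 2) (f' := fun t => 2 * inner ℝ (x t i) (deriv x t i))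
    (fun t _ => hg t)
    (by
      refine MeasureTheory.Integrable.mono' (g := fun s => (1 + 4 * C + 4 * C) * ‖x s‖ ^ 2 + 
        C * ‖x (s - τ)‖ ^ 2) ((hI0.const_mul _).add (hI2.const_mul _)) ?_ ?_
      · exact (continuous_const.mul (hci.inner hci')).aestronglyMeasurable
      · refine (MeasureTheory.ae_restrict_iff' measurableSet_Ioi).2 (Eventually.of_forall ?_)
        intro t ht
        have h1 : |inner ℝ (x t i) (deriv x t i)| ≤ ‖x t i‖ * ‖deriv x t i‖ :=
          abs_real_inner_le_norm _ _
        have h2 := norm_le_pi_norm (x t) i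
        have h3 := norm_le_pi_norm (deriv x t) i
        have h4 := hb t (le_of_lt ht)
        have h5 : ‖x t i‖ * ‖deriv x t i‖ ≤ ‖x t‖ * (C * ‖x t‖ + C * ‖x (t - τ)‖) :=
          mul_le_mul h2 (h3.trans h4) (norm_nonneg _) (norm_nonneg _)
        rw [Real.norm_eq_abs, abs_mul, abs_two]
        nlinarith [mul_nonneg hC (sq_nonneg (‖x t‖ - ‖x (t - τ)‖)), 
          mul_nonneg hC (sq_nonneg (‖x t‖)), sq_nonneg ‖x t‖])
    (by
      refine MeasureTheory.Integrable.mono' hI0 ?_ ?_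
      · exact (hci.norm.pow 2).aestronglyMeasurable
      · refine Eventually.of_forall ?_
        intro t
        have h2 := norm_le_pi_norm (x t) i
        rw [Real.norm_eq_abs, abs_of_nonneg (by positivity)]
        gcongr)
  rw [Pi.zero_apply, tendsto_zero_iff_norm_tendsto_zero]
  have := hlim.sqrt
  simpa [Real.sqrt_sq] using this

theorem crfde_delay_dependent_stability {n : ℕ}
    (A Ad : Matrix (Fin n) (Fin n) ℝ) (h : ℝ) (hh : 0 ≤ h) (σ : ℂ)
    (hLMI : ∃ P S R : Matrix (Fin n) (Fin n) ℝ,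
      P.PosDef ∧ S.PosDef ∧ R.PosDef ∧ (lmiMatrix A Ad σ h P S R).NegDefC) :
    ∀ τ : ℝ, τ ∈ Set.Icc 0 h →
      ∀ x : ℝ → (Fin n → ℂ), ContDiff ℝ 1 x →
        (∀ t : ℝ, 0 ≤ t → HasDerivAt x
          ((A.map (Complex.ofReal)).mulVec (x t)
            + σ • (Ad.map (Complex.ofReal)).mulVec (x (t - τ))) t) →
        Tendsto x atTop (nhds 0) := by
  obtain ⟨P, S, R, hP, hS, hR, hM⟩ := hLMI
  intro τ ⟨hτ0, hτh⟩ x hx hode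
  have hcx : Continuous x := hx.continuous
  have hcx' : Continuous (deriv x) := hx.continuous_deriv le_rfl
  have hd : ∀ t, HasDerivAt x (deriv x t) t := fun t =>
    (hx.differentiable one_ne_zero t).hasDerivAt
  have hode' : ∀ t, 0 ≤ t → deriv x t = (A.map (Complex.ofReal)).mulVec (x t)
            + σ • (Ad.map (Complex.ofReal)).mulVec (x (t - τ)) := fun t ht => (hode t ht).deriv
  -- bound on the derivative
  have hlin : ∀ M : Matrix (Fin n) (Fin n) ℂ, ∃ C : ℝ, 0 ≤ C ∧ ∀ v, ‖M *ᵥ v‖ ≤ C * ‖v‖ := by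
    intro M
    refine ⟨‖LinearMap.toContinuousLinearMap M.mulVecLin‖, norm_nonneg _, fun v => ?_⟩
    simpa using (LinearMap.toContinuousLinearMap M.mulVecLin).le_opNorm v
  obtain ⟨C1, hC1, hA⟩ := hlin (A.map (Complex.ofReal))
  obtain ⟨C2, hC2, hAd⟩ := hlin (σ • Ad.map (Complex.ofReal))
  have hb : ∀ t, 0 ≤ t → ‖deriv x t‖ ≤ (C1 + C2) * ‖x t‖ + (C1 + C2) * ‖x (t - τ)‖ := by
    intro t ht
    rw [hode' t ht, ← smul_mulVec]
    refine (norm_add_le _ _).trans (add_le_add ((hA _).trans ?_) ((hAd _).trans ?_))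
    · gcongr; linarith
    · gcongr; linarith
  obtain ⟨ε, hε, hneg⟩ := negdef_bound hM
  set Pc := P.map Complex.ofReal with hPc
  set Sc := S.map Complex.ofReal with hSc
  set Rc := R.map Complex.ofReal with hRc
  have hPs := BB_symm (map_herm hP.1)
  have hdiss : ∀ t, 0 ≤ t → 2 * BB Pc (x t) (deriv x t) + BB Sc (x t) (x t)
      - BB Sc (x (t - τ)) (x (t - τ)) - BB Rc (x t - x (t - τ)) (x t - x (t - τ))
      + h ^ 2 * BB Rc (deriv x t) (deriv x t) ≤ - ε * ‖x t‖ ^ 2 := by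
    intro t ht
    rw [← lmi_form A Ad σ h hP hR (x t) (x (t - τ)) (deriv x t) (hode' t ht)]
    refine (hneg _).trans ?_
    have : ‖x t‖ ≤ ‖(fun p : Fin 3 × Fin n =>
        ![x t, x (t - τ), (h : ℂ) • deriv x t] p.1 p.2)‖ := by
      refine (pi_norm_le_iff_of_nonneg (norm_nonneg _)).2 fun i => ?_
      exact norm_le_pi_norm (fun p : Fin 3 × Fin n =>
        ![x t, x (t - τ), (h : ℂ) • deriv x t] p.1 p.2) (0, i)
    have h2 := pow_le_pow_left₀ (norm_nonneg _) this 2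
    have := mul_le_mul_of_nonneg_left h2 hε.le
    linarith
  have hrc : Continuous (fun s => BB Rc (deriv x s) (deriv x s)) := BB_continuous Rc hcx' hcx'
  obtain ⟨G0, -, -, hG0⟩ := prim hrc
  obtain ⟨G1, -, -, hG1⟩ := prim (continuous_id.mul hrc)
  obtain ⟨Gs, -, -, hGs⟩ := prim (BB_continuous Sc hcx hcx)
  obtain ⟨N, hN0, hN, hNd⟩ := prim (hcx.norm.pow 2)
  have hsh : ∀ (G g : ℝ → ℝ), (∀ t, HasDerivAt G (g t) t) →
      ∀ t, HasDerivAt (fun s => G (s - τ)) (g (t - τ)) t := by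
    intro G g hG t
    exact (hG (t - τ)).comp_sub_const t τ
  set V : ℝ → ℝ := fun t => BB Pc (x t) (x t) + (Gs t - Gs (t - τ))
    + h * (G1 t - G1 (t - τ) + (τ - t) * (G0 t - G0 (t - τ))) with hV
  have hV0 : ∀ t, 0 ≤ V t := by
    intro t
    have a1 := BB_nonneg hP (x t)
    have a2 : Gs (t - τ) ≤ Gs t := mono_le (by linarith) (fun s _ => hGs s)
      (fun s _ => BB_nonneg hS (x s))
    have a3 := mono_le (f := fun s => G1 s - G1 (t - τ) + (τ - t) * (G0 s - G0 (t - τ)))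
      (f' := fun s => (s - (t - τ)) * BB Rc (deriv x s) (deriv x s))
      (a := t - τ) (b := t) (by linarith)
      (by
        intro s _
        have := ((hG1 s).sub_const (G1 (t - τ))).add
          (((hG0 s).sub_const (G0 (t - τ))).const_mul (τ - t))
        refine HasDerivAt.congr_deriv this ?_
        simp only [Pi.mul_apply, id]
        ring)
      (fun s hs => mul_nonneg (by linarith [hs.1]) (BB_nonneg hR _))
    simp only [sub_self, mul_zero, add_zero] at a3
    have := mul_nonneg hh a3
    simp only [hV]
    linarith
  have hVd : ∀ t, HasDerivAt V (2 * BB Pc (x t) (deriv x t)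
      + (BB Sc (x t) (x t) - BB Sc (x (t - τ)) (x (t - τ)))
      + h * (τ * BB Rc (deriv x t) (deriv x t) - (G0 t - G0 (t - τ)))) t := by
    intro t
    have b1 := BB_hasDerivAt Pc (hd t) (hd t)
    have b2 := (hGs t).sub (hsh _ _ hGs t)
    have b3 := (hG1 t).sub (hsh _ _ hG1 t)
    have b4 := (hG0 t).sub (hsh _ _ hG0 t)
    have b5 := ((hasDerivAt_id t).const_sub τ).mul b4
    have := (b1.add b2).add ((b3.add b5).const_mul h)
    refine HasDerivAt.congr_deriv this ?_
    rw [hPs (deriv x t) (x t)]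
    simp only [Pi.mul_apply, id, Pi.sub_apply]
    ring
  apply final_step hx hτ0 (add_nonneg hC1 hC2) hb (K := V 0 / ε)
  intro T hT
  have hN' : ∫ s in (0:ℝ)..T, ‖x s‖ ^ 2 = N T := (hN T).symm
  rw [hN', le_div_iff₀ hε]
  have := mono_le (f := fun t => -(V t + ε * N t)) hT
    (fun t _ => ((hVd t).add ((hNd t).const_mul ε)).neg) (by
      intro t ht
      have c1 := hdiss t ht.1
      have c2 := jensen hR hd hG0 hτ0 t
      have c3 : G0 (t - τ) ≤ G0 t := mono_le (by linarith) (fun s _ => hG0 s)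
        (fun s _ => BB_nonneg hR _)
      have c4 := BB_nonneg hR (deriv x t)
      have c5 : τ * (G0 t - G0 (t - τ)) ≤ h * (G0 t - G0 (t - τ)) :=
        mul_le_mul_of_nonneg_right hτh (by linarith)
      have c6 : h * (τ * BB Rc (deriv x t) (deriv x t)) ≤ h ^ 2 * BB Rc (deriv x t) (deriv x t) := by
        rw [sq, mul_assoc]
        exact mul_le_mul_of_nonneg_left (mul_le_mul_of_nonneg_right hτh c4) hh
      simp only [Pi.pow_apply]
      linarith)
  simp only [hN0] at this
  have := hV0 T
  linarith
end
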